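/- Wavelet theorem: in any execution from a configuration in WU₀ in which every process has infinitely many events, let k ≥ ⊥₀ + D and let ρ ≥ 1 be an integer. Then the segment [C_k, C_{k+ρ}], with the events of C_{k+ρ} as decide events, is a ρ-wavelet: for every process p and every process q with d(p,q) ≤ ρ, there exists a time t' with t_{q,k} ≤ t' ≤ t_{q,k+ρ} such that (q,t') ≼ (p, t_{p,k+ρ}); i.e., the past of each decide event (p, t_{p,k+ρ}) within [C_k, C_{k+ρ}] covers the ρ-ball V(p,ρ). -/

import Mathlib

open SimpleGraph

/-- The incrementing function `φ`: `φ(x) = (x+1) mod K` if `x ≥ 0`, and `x+1` if `x < 0`. -/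
def phiInc (K x : ℤ) : ℤ := if 0 ≤ x then (x + 1) % K else x + 1

/-- `dsub K a b` is `b ⊖ a`: `(b−a) mod K` if this residue is `≤ 1`, else `−((a−b) mod K)`,
for locally comparable ring values. -/
def dsub (K a b : ℤ) : ℤ := if (b - a) % K ≤ 1 then (b - a) % K else -((a - b) % K)

/-- Two ring values are locally comparable if `min((a−b) mod K, (b−a) mod K) ≤ 1`. -/
def LocComp (K a b : ℤ) : Prop := min ((a - b) % K) ((b - a) % K) ≤ 1

/-- `γ` takes values in `X = {−α,…,K−1}`. -/
def InX {V : Type*} (K α : ℤ) (γ : V → ℤ) : Prop := ∀ p : V, -α ≤ γ p ∧ γ p < K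

/-- The predicate `WU`: every process has a ring value (`{0,…,K−1}`) locally comparable
with the value of each of its neighbors. -/
def WU {V : Type*} (G : SimpleGraph V) (K : ℤ) (γ : V → ℤ) : Prop :=
  ∀ p q : V, G.Adj p q → (0 ≤ γ p ∧ γ p < K) ∧ LocComp K (γ p) (γ q)

/-- The delay of a walk: the sum of `γ(next) ⊖ γ(current)` along its edges. -/
def walkDelay {V : Type*} {G : SimpleGraph V} (K : ℤ) (γ : V → ℤ)
    {p q : V} (w : G.Walk p q) : ℤ :=
  (w.darts.map (fun d => dsub K (γ d.fst) (γ d.snd))).sum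

/-- The delay is intrinsic: independent of the choice of the path. -/
def Intrinsic {V : Type*} (G : SimpleGraph V) (K : ℤ) (γ : V → ℤ) : Prop :=
  ∀ p q : V, ∀ w₁ w₂ : G.Walk p q, walkDelay K γ w₁ = walkDelay K γ w₂

/-- `WU₀`: `WU` together with intrinsic delay. -/
def WU0 {V : Type*} (G : SimpleGraph V) (K : ℤ) (γ : V → ℤ) : Prop :=
  WU G K γ ∧ Intrinsic G K γ

/-- The normal action `NA` is enabled at `p`: `γ(p)` is a ring value and every neighbor `q`
satisfies `γ(q) = γ(p)` or `γ(q) = φ(γ(p))`. -/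
def NAenabled {V : Type*} (G : SimpleGraph V) (K : ℤ) (γ : V → ℤ) (p : V) : Prop :=
  (0 ≤ γ p ∧ γ p < K) ∧ ∀ q : V, G.Adj p q → γ q = γ p ∨ γ q = phiInc K (γ p)

/-- An NA-step: a nonempty set `S` of processes at which `NA` is enabled in `γ`
simultaneously execute it, all other processes keeping their value. -/
def NAstep {V : Type*} (G : SimpleGraph V) (K : ℤ) (γ γ' : V → ℤ) (S : Set V) : Prop :=
  S.Nonempty ∧ (∀ p ∈ S, NAenabled G K γ p) ∧
    ∀ p : V, (p ∈ S → γ' p = phiInc K (γ p)) ∧ (p ∉ S → γ' p = γ p)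

/-- `(p,t)` is an event: `t = 0`, or `p` executes `NA` in the step `γ_{t−1} ↦ γ_t`. -/
def isEvent {V : Type*} (sched : ℕ → Set V) (p : V) (t : ℕ) : Prop :=
  t = 0 ∨ ∃ s, t = s + 1 ∧ p ∈ sched s

/-- The causal relation `⤳` on events. -/
inductive Leads {V : Type*} (G : SimpleGraph V) (sched : ℕ → Set V) :
    V × ℕ → V × ℕ → Prop
  | self {p : V} {t' t : ℕ} : isEvent sched p t' → isEvent sched p t → t' < t →
      (∀ s, t' < s → s < t → ¬ isEvent sched p s) → Leads G sched (p, t') (p, t)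
  | nbr {p q : V} {t' t : ℕ} : G.Adj p q → isEvent sched p t → 0 < t →
      isEvent sched q t' → t' < t → (∀ s, t' < s → s < t → ¬ isEvent sched q s) →
      Leads G sched (q, t') (p, t)

/-- The causal order `≼`: reflexive-transitive closure of `⤳`. -/
def CausalLe {V : Type*} (G : SimpleGraph V) (sched : ℕ → Set V) :
    V × ℕ → V × ℕ → Prop :=
  Relation.ReflTransGen (Leads G sched)

/-- The lifted clock `ṽ(p,t) = ⊥₀ + δ(p₀,p) + #{s : 0 < s ≤ t and (p,s) is an event}`. -/
noncomputable def liftClock {V : Type*} (sched : ℕ → Set V) (bot0 : ℤ) (δ0 : V → ℤ)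
    (p : V) (t : ℕ) : ℤ :=
  bot0 + δ0 p + Nat.card {s : ℕ // 0 < s ∧ s ≤ t ∧ isEvent sched p s}

section Causality

variable {V : Type*} {sched : ℕ → Set V}

lemma isEvent_succ {p : V} {t : ℕ} : isEvent sched p (t + 1) ↔ p ∈ sched t := by
  simp [isEvent]

/-- The latest event of `q` up to time `t`. -/
lemma exists_last_event (q : V) (t : ℕ) :
    ∃ t' ≤ t, isEvent sched q t' ∧ ∀ s, t' < s → s ≤ t → ¬ isEvent sched q s := by
  induction t with
  | zero => exact ⟨0, le_rfl, Or.inl rfl, fun s h h' => by omega⟩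
  | succ t ih =>
    by_cases h : isEvent sched q (t + 1)
    · exact ⟨t + 1, le_rfl, h, fun s h h' => by omega⟩
    · obtain ⟨t', ht', hev, hlast⟩ := ih
      refine ⟨t', by omega, hev, fun s hs hst => ?_⟩
      rcases Nat.lt_or_ge t s with h' | h'
      · obtain rfl : s = t + 1 := by omega
        exact h
      · exact hlast s hs h'

/-- Events of a single process are causally ordered by time. -/
lemma causalLe_of_le (G : SimpleGraph V) {q : V} {s t : ℕ} (hs : isEvent sched q s)
    (ht : isEvent sched q t) (hst : s ≤ t) : CausalLe G sched (q, s) (q, t) := by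
  induction t using Nat.strong_induction_on with
  | _ t ih =>
    rcases hst.eq_or_lt with rfl | hlt
    · exact Relation.ReflTransGen.refl
    · obtain ⟨t', ht', hev, hlast⟩ := exists_last_event (sched := sched) q (t - 1)
      have hst' : s ≤ t' := by
        by_contra! h
        exact hlast s h (by omega) hs
      exact (ih t' (by omega) hev hst').tail
        (Leads.self hev ht (by omega) fun r h h' => hlast r h (by omega))

end Causality

section LiftedClock

variable {V : Type*} (sched : ℕ → Set V) (b : ℤ) (δ : V → ℤ) (p : V)

lemma liftClock_zero : liftClock sched b δ p 0 = b + δ p := by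
  have : IsEmpty {s : ℕ // 0 < s ∧ s ≤ 0 ∧ isEvent sched p s} := ⟨fun s => by
    have := s.2.1
    have := s.2.2.1
    omega⟩
  simp only [liftClock, Nat.card_of_isEmpty, Nat.cast_zero, add_zero]

variable {sched p}

lemma liftClock_succ_of_mem {t : ℕ} (h : p ∈ sched t) :
    liftClock sched b δ p (t + 1) = liftClock sched b δ p t + 1 := by
  have hset : {s : ℕ | 0 < s ∧ s ≤ t + 1 ∧ isEvent sched p s} =
      insert (t + 1) {s : ℕ | 0 < s ∧ s ≤ t ∧ isEvent sched p s} := by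
    ext s
    simp only [Set.mem_ofPred_eq, Set.mem_insert_iff]
    constructor
    · rintro ⟨h0, hs, hev⟩
      rcases hs.eq_or_lt with rfl | hs
      · exact Or.inl rfl
      · exact Or.inr ⟨h0, by omega, hev⟩
    · rintro (rfl | ⟨h0, hs, hev⟩)
      · exact ⟨by omega, le_rfl, isEvent_succ.2 h⟩
      · exact ⟨h0, by omega, hev⟩
  have hfin : {s : ℕ | 0 < s ∧ s ≤ t ∧ isEvent sched p s}.Finite :=
    (Set.finite_Iic t).subset fun s hs => hs.2.1
  have hcard : Nat.card {s : ℕ // 0 < s ∧ s ≤ t + 1 ∧ isEvent sched p s} =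
      Nat.card {s : ℕ // 0 < s ∧ s ≤ t ∧ isEvent sched p s} + 1 := by
    change Set.ncard {s : ℕ | 0 < s ∧ s ≤ t + 1 ∧ isEvent sched p s} =
      Set.ncard {s : ℕ | 0 < s ∧ s ≤ t ∧ isEvent sched p s} + 1
    rw [hset, Set.ncard_insert_of_notMem (fun h => by have := h.2.1; omega) hfin]
  simp only [liftClock, hcard]
  push_cast
  ring

lemma liftClock_succ_of_notMem {t : ℕ} (h : p ∉ sched t) :
    liftClock sched b δ p (t + 1) = liftClock sched b δ p t := by
  have hiff : ∀ s, (0 < s ∧ s ≤ t + 1 ∧ isEvent sched p s) ↔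
      (0 < s ∧ s ≤ t ∧ isEvent sched p s) := by
    refine fun s => ⟨fun ⟨h0, hs, hev⟩ => ⟨h0, ?_, hev⟩, fun ⟨h0, hs, hev⟩ => ⟨h0, by omega, hev⟩⟩
    rcases hs.eq_or_lt with rfl | hs
    · exact absurd (isEvent_succ.1 hev) h
    · omega
  simp only [liftClock, hiff]

lemma liftClock_mono : Monotone (liftClock sched b δ p) := by
  refine monotone_nat_of_le_succ fun t => ?_
  by_cases h : p ∈ sched t
  · rw [liftClock_succ_of_mem b δ h]
    omega
  · rw [liftClock_succ_of_notMem b δ h]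

lemma liftClock_eq_of_no_event {s t : ℕ} (hst : s ≤ t)
    (h : ∀ r, s < r → r ≤ t → ¬ isEvent sched p r) :
    liftClock sched b δ p t = liftClock sched b δ p s := by
  induction t, hst using Nat.le_induction with
  | base => rfl
  | succ t hst ih =>
    rw [liftClock_succ_of_notMem b δ fun hp => h (t + 1) (by omega) le_rfl (isEvent_succ.2 hp)]
    exact ih fun r hr hrt => h r hr (by omega)

/-- The first time at which the lifted clock takes a given value is an event. -/
lemma isEvent_of_first {m : ℤ} {t : ℕ} (ht : liftClock sched b δ p t = m)
    (hfirst : ∀ s, liftClock sched b δ p s = m → t ≤ s) : isEvent sched p t := by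
  cases t with
  | zero => exact Or.inl rfl
  | succ t =>
    by_contra hne
    have h := hfirst t
      ((liftClock_succ_of_notMem b δ fun hp => hne (isEvent_succ.2 hp)).symm.trans ht)
    omega

end LiftedClock

section Delay

variable {V : Type*} {G : SimpleGraph V} {K : ℤ}

lemma dvd_dsub_sub (K a b : ℤ) : K ∣ dsub K a b - (b - a) := by
  unfold dsub
  split_ifs
  · exact Int.dvd_emod_sub_self
  · have h : K ∣ (a - b) - (a - b) % K := Int.dvd_self_sub_emod
    convert h using 1
    ring

lemma dsub_le_one (hK : 0 < K) (a b : ℤ) : dsub K a b ≤ 1 := by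
  unfold dsub
  split_ifs with h
  · exact h
  · have := Int.emod_nonneg (a - b) hK.ne'
    omega

lemma LocComp.neg_one_le_dsub (hK : 0 < K) {a b : ℤ} (h : LocComp K a b) :
    -1 ≤ dsub K a b := by
  unfold LocComp at h
  unfold dsub
  have := Int.emod_nonneg (b - a) hK.ne'
  split_ifs with hle
  · omega
  · rcases min_le_iff.1 h with h | h <;> omega

lemma walkDelay_cons (γ : V → ℤ) {u v w : V} (h : G.Adj u v) (p : G.Walk v w) :
    walkDelay K γ (Walk.cons h p) = dsub K (γ u) (γ v) + walkDelay K γ p := by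
  simp [walkDelay]

lemma walkDelay_concat (γ : V → ℤ) {u v w : V} (p : G.Walk u v) (h : G.Adj v w) :
    walkDelay K γ (p.concat h) = walkDelay K γ p + dsub K (γ v) (γ w) := by
  simp [walkDelay, Walk.darts_concat, List.concat_eq_append]

lemma dvd_walkDelay_sub (γ : V → ℤ) {u v : V} (w : G.Walk u v) :
    K ∣ walkDelay K γ w - (γ v - γ u) := by
  induction w with
  | nil => simp [walkDelay]
  | @cons u v x h p ih =>
    rw [walkDelay_cons]
    convert Int.dvd_add (dvd_dsub_sub K (γ u) (γ v)) ih using 1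
    ring

lemma walkDelay_le_length (hK : 0 < K) (γ : V → ℤ) {u v : V} (w : G.Walk u v) :
    walkDelay K γ w ≤ w.length := by
  induction w with
  | nil => simp [walkDelay]
  | @cons u v x h p ih =>
    rw [walkDelay_cons, Walk.length_cons]
    have := dsub_le_one hK (γ u) (γ v)
    push_cast
    omega

end Delay

section Execution

variable {V : Type*} {G : SimpleGraph V} {K : ℤ} {sched : ℕ → Set V} {b : ℤ} {δ : V → ℤ}

lemma dvd_phiInc_sub (K : ℤ) {x : ℤ} (hx : 0 ≤ x) : K ∣ phiInc K x - (x + 1) := by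
  rw [phiInc, if_pos hx]
  exact Int.dvd_emod_sub_self

/-- If the lift `c` of `γ` differs by at most one between neighbors, then an enabled process is
not ahead of its neighbors. -/
lemma NAenabled.lift_le (hK : 3 ≤ K) {γ c : V → ℤ} (hlift : ∀ p, K ∣ c p - γ p) {p q : V}
    (hpq : G.Adj p q) (hclose : c p ≤ c q + 1) (hen : NAenabled G K γ p) : c p ≤ c q := by
  by_contra! hlt
  have hc : c p = c q + 1 := by omega
  rcases hen.2 q hpq with h | h
  · have hd : K ∣ 1 := by
      convert Int.dvd_sub (hlift p) (hlift q) using 1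
      rw [hc, h]
      ring
    have := Int.le_of_dvd one_pos hd
    omega
  · have hd : K ∣ 2 := by
      convert Int.dvd_sub (Int.dvd_sub (hlift p) (hlift q)) (dvd_phiInc_sub K hen.1.1) using 1
      rw [hc, h]
      ring
    have := Int.le_of_dvd two_pos hd
    omega

/-- The lifted clock keeps lifting the configuration, and neighbors stay within one unit of each
other. -/
lemma liftClock_invariant (hK : 3 ≤ K) {e : ℕ → V → ℤ}
    (hexec : ∀ t, NAstep G K (e t) (e (t + 1)) (sched t))
    (hlift : ∀ p, K ∣ b + δ p - e 0 p) (hclose : ∀ p q, G.Adj p q → δ p ≤ δ q + 1) (t : ℕ) :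
    (∀ p, K ∣ liftClock sched b δ p t - e t p) ∧
      ∀ p q, G.Adj p q → liftClock sched b δ p t ≤ liftClock sched b δ q t + 1 := by
  induction t with
  | zero =>
    simp only [liftClock_zero]
    exact ⟨hlift, fun p q h => by have := hclose p q h; omega⟩
  | succ t ih =>
    obtain ⟨-, hen, hstep⟩ := hexec t
    refine ⟨fun p => ?_, fun p q h => ?_⟩
    · by_cases hp : p ∈ sched t
      · rw [liftClock_succ_of_mem b δ hp, (hstep p).1 hp]
        convert Int.dvd_sub (ih.1 p) (dvd_phiInc_sub K (hen p hp).1.1) using 1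
        ring
      · rw [liftClock_succ_of_notMem b δ hp, (hstep p).2 hp]
        exact ih.1 p
    · have hq : liftClock sched b δ q t ≤ liftClock sched b δ q (t + 1) :=
        liftClock_mono b δ t.le_succ
      by_cases hp : p ∈ sched t
      · have := (hen p hp).lift_le hK ih.1 h (ih.2 p q h)
        rw [liftClock_succ_of_mem b δ hp]
        omega
      · rw [liftClock_succ_of_notMem b δ hp]
        have := ih.2 p q h
        omega

/-- The past of an event covers the processes along any walk, losing at most one clock unit per
edge, as long as clock values stay above the initial ones. -/
lemma exists_causalLe_of_walk
    (hle : ∀ t p q, p ∈ sched t → G.Adj p q →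
      liftClock sched b δ p t ≤ liftClock sched b δ q t)
    {k : ℤ} (hinit : ∀ p, b + δ p ≤ k) {p q : V} (w : G.Walk p q) {t : ℕ}
    (ht : isEvent sched p t) (hkt : k + w.length ≤ liftClock sched b δ p t) :
    ∃ t', isEvent sched q t' ∧ k ≤ liftClock sched b δ q t' ∧
      CausalLe G sched (q, t') (p, t) := by
  induction w generalizing t with
  | nil => exact ⟨t, ht, by simpa using hkt, Relation.ReflTransGen.refl⟩
  | @cons u v x h w ih =>
    rw [Walk.length_cons] at hkt
    push_cast at hkt
    cases t with
    | zero =>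
      have := hinit u
      rw [liftClock_zero] at hkt
      omega
    | succ s =>
      have hu : u ∈ sched s := isEvent_succ.1 ht
      obtain ⟨s', hs', hev, hlast⟩ := exists_last_event (sched := sched) v s
      have hclock := liftClock_eq_of_no_event b δ hs' hlast
      have hvle := hle s u v hu h
      rw [liftClock_succ_of_mem b δ hu] at hkt
      obtain ⟨t', hev', hk', hc⟩ := ih hev (by omega)
      exact ⟨t', hev', hk', hc.tail
        (Leads.nbr h ht s.succ_pos hev (by omega) fun r hr hr' => hlast r hr (by omega))⟩

end Execution

/-- Wavelet theorem: in any execution from a configuration in `WU₀` in which every process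
has infinitely many events, let `k ≥ ⊥₀ + D` and `ρ ≥ 1`.  Then the segment
`[C_k, C_{k+ρ}]`, with the events of `C_{k+ρ}` as decide events, is a `ρ`-wavelet: for
every process `p` and every `q` with `d(p,q) ≤ ρ` there is a time `t'` with
`t_{q,k} ≤ t' ≤ t_{q,k+ρ}` such that `(q,t') ≼ (p, t_{p,k+ρ})`; i.e., the past of each
decide event `(p, t_{p,k+ρ})` within `[C_k, C_{k+ρ}]` covers the `ρ`-ball `V(p,ρ)`.
Here `t_{p,m}` is characterized as the least time at which the lifted clock of `p`
equals `m`. -/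
theorem wavelet_theorem {V : Type*} [Fintype V] (G : SimpleGraph V)
    (hconn : G.Connected) (hn : 2 ≤ Fintype.card V)
    (K α : ℤ) (hK : 3 ≤ K) (hα : 0 ≤ α)
    (e : ℕ → V → ℤ) (sched : ℕ → Set V)
    (hX : ∀ t, ∀ p : V, -α ≤ e t p ∧ e t p < K)
    (hWU0 : WU G K (e 0) ∧ Intrinsic G K (e 0))
    (hexec : ∀ t, NAstep G K (e t) (e (t + 1)) (sched t))
    (hinf : ∀ (p : V) (T : ℕ), ∃ t, T < t ∧ isEvent sched p t)
    (p₀ : V) (δ0 : V → ℤ)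
    (hδ0 : ∀ q : V, ∀ w : G.Walk p₀ q, walkDelay K (e 0) w = δ0 q)
    (hmin : ∀ q : V, 0 ≤ δ0 q)
    (k : ℤ) (hk : e 0 p₀ + (G.diam : ℤ) ≤ k)
    (ρ : ℕ) (hρ : 1 ≤ ρ) :
    ∀ p q : V, G.dist p q ≤ ρ →
      ∀ tpk' tqk tqk' : ℕ,
        (liftClock sched (e 0 p₀) δ0 p tpk' = k + ρ ∧
          ∀ s, liftClock sched (e 0 p₀) δ0 p s = k + ρ → tpk' ≤ s) →
        (liftClock sched (e 0 p₀) δ0 q tqk = k ∧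
          ∀ s, liftClock sched (e 0 p₀) δ0 q s = k → tqk ≤ s) →
        (liftClock sched (e 0 p₀) δ0 q tqk' = k + ρ ∧
          ∀ s, liftClock sched (e 0 p₀) δ0 q s = k + ρ → tqk' ≤ s) →
        ∃ t' : ℕ, tqk ≤ t' ∧ t' ≤ tqk' ∧ isEvent sched q t' ∧
          CausalLe G sched (q, t') (p, tpk') := by
  intro p q hpq tpk' tqk tqk' ⟨hp, hpfirst⟩ ⟨hq, hqfirst⟩ ⟨hq', hqfirst'⟩
  have hK0 : 0 < K := by omega
  have hinit : ∀ x, e 0 p₀ + δ0 x ≤ k := fun x => by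
    have : Nonempty V := ⟨p₀⟩
    obtain ⟨w, hw⟩ := hconn.exists_walk_length_eq_dist p₀ x
    have hlen := walkDelay_le_length hK0 (e 0) w
    have hdiam : G.dist p₀ x ≤ G.diam :=
      SimpleGraph.dist_le_diam (SimpleGraph.connected_iff_ediam_ne_top.1 hconn)
    rw [hδ0 x w, hw] at hlen
    omega
  have hlift : ∀ x, K ∣ e 0 p₀ + δ0 x - e 0 x := fun x => by
    obtain ⟨w⟩ := hconn.preconnected p₀ x
    have h := dvd_walkDelay_sub (K := K) (e 0) w
    rw [hδ0 x w] at h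
    convert h using 1
    ring
  have hclose : ∀ x y, G.Adj x y → δ0 x ≤ δ0 y + 1 := fun x y h => by
    obtain ⟨w⟩ := hconn.preconnected p₀ x
    have hconcat := walkDelay_concat (K := K) (e 0) w h
    rw [hδ0 x w, hδ0 y] at hconcat
    have := (hWU0.1 x y h).2.neg_one_le_dsub hK0
    omega
  have hinv := liftClock_invariant hK hexec hlift hclose
  have hle : ∀ t x y, x ∈ sched t → G.Adj x y →
      liftClock sched (e 0 p₀) δ0 x t ≤ liftClock sched (e 0 p₀) δ0 y t := fun t x y hx h =>
    ((hexec t).2.1 x hx).lift_le hK (hinv t).1 h ((hinv t).2 x y h)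
  obtain ⟨w, hw⟩ := hconn.exists_walk_length_eq_dist p q
  obtain ⟨t', hev, hkt', hcausal⟩ := exists_causalLe_of_walk hle hinit w
    (isEvent_of_first _ _ hp hpfirst) (by omega)
  have hev' := isEvent_of_first _ _ hq' hqfirst'
  have first_le : ∀ t, k ≤ liftClock sched (e 0 p₀) δ0 q t → tqk ≤ t := fun t ht => by
    by_contra! hlt
    have hmono : liftClock sched (e 0 p₀) δ0 q t ≤ liftClock sched (e 0 p₀) δ0 q tqk :=
      liftClock_mono _ _ hlt.le
    exact absurd (hqfirst t (by omega)) (by omega)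
  rcases le_total t' tqk' with h | h
  · exact ⟨t', first_le t' hkt', h, hev, hcausal⟩
  · exact ⟨tqk', first_le tqk' (by omega), le_rfl, hev',
      (causalLe_of_le G hev' hev h).trans hcausal⟩
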